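/- arXiv:2509.22580 — 5 statements merged into one kernel-verified Lean document; each statement's English description precedes it below -/
import Mathlib

section
/- Let Ω be a finite type with |Ω| ≥ 2, let A : Ω → ℝ satisfy 0 ≤ A(ω) ≤ 1 for all ω, and let μ = (1/|Ω|)·Σ_{ω ∈ Ω} A(ω). Fix 1 ≤ L ≤ |Ω|, a tolerance ε > 0 and a failure probability δ ∈ (0,1). Suppose L · (|Ω| − L)/(|Ω| − 1) ≥ ln(2|Ω|/δ) / (2ε²). Then, under the uniform distribution on injective functions s : Fin L → Ω, the probability that |(1/L)·Σ_{l} A(s(l)) − μ| ≤ ε is at least 1 − δ. -/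
open scoped Classical

lemma aux_swap {Ω : Type*} [Fintype Ω] (x : Ω → ℝ) (hx : ∀ ω, 0 ≤ x ω) (L : ℕ) (l : Fin L)
    (s : Fin L ↪ Ω) (w : Ω) :
    0 ≤ (∏ i, x (s i) - ∏ i, x ((Equiv.swap (s l) w) (s i))) * (x (s l) - x w) := by
  by_cases h : ∃ j, s j = w
  · obtain ⟨j, rfl⟩ := h
    have : ∏ i, x ((Equiv.swap (s l) (s j)) (s i)) = ∏ i, x (s i) := by
      rw [← Equiv.prod_comp (Equiv.swap l j) (fun i => x (s i))]
      refine Finset.prod_congr rfl fun i _ => ?_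
      rw [← s.injective.map_swap]
    rw [this]; simp
  · push Not at h
    have h1 : ∏ i, x (s i) = x (s l) * ∏ i ∈ Finset.univ.erase l, x (s i) :=
      (Finset.mul_prod_erase _ _ (Finset.mem_univ l)).symm
    have h2 : ∏ i, x ((Equiv.swap (s l) w) (s i)) =
        x w * ∏ i ∈ Finset.univ.erase l, x (s i) := by
      rw [← Finset.mul_prod_erase _ _ (Finset.mem_univ l), Equiv.swap_apply_left]
      congr 1
      refine Finset.prod_congr rfl fun i hi => ?_
      rw [Equiv.swap_apply_of_ne_of_ne _ (h i)]
      exact fun h => (Finset.ne_of_mem_erase hi) (s.injective h)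
    rw [h1, h2, ← sub_mul]
    have : 0 ≤ ∏ i ∈ Finset.univ.erase l, x (s i) := Finset.prod_nonneg fun i _ => hx _
    nlinarith [mul_nonneg this (sq_nonneg (x (s l) - x w))]

lemma aux_corr {Ω : Type*} [Fintype Ω] (x : Ω → ℝ) (hx : ∀ ω, 0 ≤ x ω) (L : ℕ) (l : Fin L) :
    0 ≤ ∑ p : (Fin L ↪ Ω) × Ω, (∏ i, x (p.1 i)) * (x (p.1 l) - x p.2) := by
  let f : (Fin L ↪ Ω) × Ω → (Fin L ↪ Ω) × Ω := fun p =>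
    (p.1.trans (Equiv.swap (p.1 l) p.2).toEmbedding, p.1 l)
  have hf : Function.Involutive f := by
    rintro ⟨s, w⟩
    refine Prod.ext ?_ ?_
    · ext i
      simp [f, Equiv.swap_comm w (s l)]
    · simp [f]
  have key := Equiv.sum_comp (Function.Involutive.toPerm f hf)
    (fun p : (Fin L ↪ Ω) × Ω => (∏ i, x (p.1 i)) * (x (p.1 l) - x p.2))
  have h2 : 0 ≤ ∑ p : (Fin L ↪ Ω) × Ω, ((∏ i, x (p.1 i)) * (x (p.1 l) - x p.2)
      + (∏ i, x ((f p).1 i)) * (x ((f p).1 l) - x (f p).2)) := by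
    refine Finset.sum_nonneg fun p _ => ?_
    have := aux_swap x hx L l p.1 p.2
    simp only [f, Function.Embedding.trans_apply,
      Equiv.coe_toEmbedding, Equiv.swap_apply_left]
    linarith
  simp only [Function.Involutive.coe_toPerm] at key
  rw [Finset.sum_add_distrib, key] at h2
  linarith

lemma aux_step {Ω : Type*} [Fintype Ω] (x : Ω → ℝ) (L : ℕ) :
    ∑ s : Fin (L+1) ↪ Ω, ∏ i, x (s i) =
      ∑ s : Fin L ↪ Ω, (∏ i, x (s i)) * (∑ w, x w - ∑ l, x (s l)) := by
  rw [← Equiv.sum_comp (Equiv.embeddingFinSucc L Ω).symm, Fintype.sum_sigma]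
  refine Finset.sum_congr rfl fun s _ => ?_
  have h1 : ∀ a : {i // i ∉ Set.range s},
      ∏ i, x ((Equiv.embeddingFinSucc L Ω).symm ⟨s, a⟩ i) = (∏ i, x (s i)) * x a := by
    intro a
    rw [Fin.prod_univ_succ, mul_comm]
    simp
  simp_rw [h1]
  rw [← Finset.mul_sum]
  congr 1
  rw [eq_sub_iff_add_eq, ← Finset.sum_map Finset.univ s x]
  rw [← Finset.sum_compl_add_sum (Finset.univ.map s) x]
  congr 1
  symm
  apply Finset.sum_subtype
  intro w
  simp

lemma aux_mac {Ω : Type*} [Fintype Ω] (x : Ω → ℝ) (hx : ∀ ω, 0 ≤ x ω) (m : ℝ)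
    (hm : ∑ w, x w = Fintype.card Ω * m) (hN : 0 < Fintype.card Ω) (L : ℕ)
    (hL : L ≤ Fintype.card Ω) :
    ∑ s : Fin L ↪ Ω, ∏ i, x (s i) ≤ ((Fintype.card Ω).descFactorial L : ℝ) * m ^ L := by
  have hNr : (0:ℝ) < Fintype.card Ω := by exact_mod_cast hN
  have hm0 : 0 ≤ m := by
    have : 0 ≤ ∑ w, x w := Finset.sum_nonneg fun w _ => hx w
    rw [hm] at this
    exact nonneg_of_mul_nonneg_right this hNr
  induction L with
  | zero => simp
  | succ L ih =>
    have ih := ih (by omega)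
    have hc : ∀ l : Fin L, 0 ≤ ∑ s : Fin L ↪ Ω, (∏ i, x (s i)) * (x (s l) - m) := by
      intro l
      have := aux_corr x hx L l
      rw [Fintype.sum_prod_type] at this
      have h2 : ∀ s : Fin L ↪ Ω, ∑ w, (∏ i, x (s i)) * (x (s l) - x w)
          = Fintype.card Ω * ((∏ i, x (s i)) * (x (s l) - m)) := by
        intro s
        rw [← Finset.mul_sum, Finset.sum_sub_distrib, hm]
        simp; ring
      simp_rw [h2] at this
      rw [← Finset.mul_sum] at this
      exact nonneg_of_mul_nonneg_right this hNr
    have hs := Finset.sum_nonneg fun l (_ : l ∈ Finset.univ) => hc l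
    rw [Finset.sum_comm] at hs
    rw [aux_step, hm, Nat.descFactorial_succ]
    have h3 : ∑ s : Fin L ↪ Ω, (∏ i, x (s i)) * (Fintype.card Ω * m - ∑ l, x (s l))
      = (Fintype.card Ω - L) * m * ∑ s : Fin L ↪ Ω, (∏ i, x (s i))
        - ∑ s : Fin L ↪ Ω, ∑ l, (∏ i, x (s i)) * (x (s l) - m) := by
      rw [Finset.mul_sum, ← Finset.sum_sub_distrib]
      refine Finset.sum_congr rfl fun s _ => ?_
      rw [← Finset.mul_sum, Finset.sum_sub_distrib]
      simp; ring
    rw [h3]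
    have hLr : (L:ℝ) ≤ Fintype.card Ω := by exact_mod_cast (by omega : L ≤ Fintype.card Ω)
    push_cast [Nat.cast_sub (by omega : L ≤ Fintype.card Ω)]
    have := mul_le_mul_of_nonneg_left ih (mul_nonneg (sub_nonneg.2 hLr) hm0)
    rw [pow_succ]
    linarith

lemma aux_hoeff {Ω : Type*} [Fintype Ω] [Nonempty Ω] (B : Ω → ℝ) (a b : ℝ)
    (hB : ∀ w, B w ∈ Set.Icc a b) (hab : b - a = 1) (h0 : ∑ w, B w = 0) (t : ℝ) :
    ∑ w, Real.exp (t * B w) ≤ Fintype.card Ω * Real.exp (t ^ 2 / 8) := by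
  letI : MeasurableSpace Ω := ⊤
  have hN : (0:ℝ) < Fintype.card Ω := by exact_mod_cast Fintype.card_pos
  let P := (PMF.uniformOfFintype Ω).toMeasure
  have hi : ∀ f : Ω → ℝ, ∫ w, f w ∂P = (Fintype.card Ω : ℝ)⁻¹ * ∑ w, f w := by
    intro f
    rw [PMF.integral_eq_sum, Finset.mul_sum]
    simp
  have h := ProbabilityTheory.hasSubgaussianMGF_of_mem_Icc_of_integral_eq_zero (μ := P) (X := B)
    (a := a) (b := b) (measurable_of_finite B).aemeasurable (Filter.Eventually.of_forall hB)
    (by rw [hi, h0, mul_zero])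
  have h2 := h.mgf_le t
  rw [ProbabilityTheory.mgf, hi, inv_mul_le_iff₀ hN] at h2
  refine h2.trans (le_of_eq ?_)
  rw [hab]; congr 2; simp; ring

lemma aux_tail {Ω : Type*} [Fintype Ω] [Nonempty Ω] (B : Ω → ℝ) (a b : ℝ)
    (hB : ∀ w, B w ∈ Set.Icc a b) (hab : b - a = 1) (h0 : ∑ w, B w = 0) (L : ℕ)
    (hL : L ≤ Fintype.card Ω) (ε : ℝ) (hε : 0 < ε) :
    ((Finset.univ.filter (fun s : Fin L ↪ Ω => L * ε < ∑ l, B (s l))).card : ℝ)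
      ≤ (Fintype.card Ω).descFactorial L * Real.exp (-(2 * L * ε ^ 2)) := by
  have hN : (0:ℝ) < Fintype.card Ω := by exact_mod_cast Fintype.card_pos
  have hh := aux_hoeff B a b hB hab h0 (4 * ε)
  have hm := aux_mac (fun w => Real.exp (4 * ε * B w)) (fun _ => (Real.exp_pos _).le)
    ((∑ w, Real.exp (4 * ε * B w)) / Fintype.card Ω) (by field_simp) Fintype.card_pos L hL
  have hp : ((∑ w, Real.exp (4 * ε * B w)) / Fintype.card Ω) ^ L ≤ Real.exp (2 * L * ε ^ 2) := by
    have : (∑ w, Real.exp (4 * ε * B w)) / Fintype.card Ω ≤ Real.exp ((4 * ε) ^ 2 / 8) := by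
      rw [div_le_iff₀ hN]; linarith
    refine (pow_le_pow_left₀ (by positivity) this L).trans (le_of_eq ?_)
    rw [← Real.exp_nat_mul]; congr 1; ring
  have hm2 := hm.trans (mul_le_mul_of_nonneg_left hp (Nat.cast_nonneg _))
  have hc : ((Finset.univ.filter (fun s : Fin L ↪ Ω => L * ε < ∑ l, B (s l))).card : ℝ)
      * Real.exp (4 * L * ε ^ 2) ≤ ∑ s : Fin L ↪ Ω, ∏ i, Real.exp (4 * ε * B (s i)) := by
    rw [← nsmul_eq_mul]
    refine (Finset.card_nsmul_le_sum _ (fun s : Fin L ↪ Ω => ∏ i, Real.exp (4 * ε * B (s i))) _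
      ?_).trans (Finset.sum_le_sum_of_subset_of_nonneg (Finset.filter_subset _ _) fun _ _ _ => by positivity)
    intro s hs
    rw [Finset.mem_filter] at hs
    rw [← Real.exp_sum, ← Finset.mul_sum, Real.exp_le_exp]
    nlinarith [hs.2]
  have h4 := hc.trans hm2
  rw [← le_div_iff₀ (Real.exp_pos _)] at h4
  refine h4.trans (le_of_eq ?_)
  rw [mul_div_assoc, ← Real.exp_sub]; congr 2; ring

/-- Sample-complexity guarantee for sampling without replacement (modeled by the uniform
distribution on injective functions `Fin L ↪ Ω`): if
`L·(|Ω|−L)/(|Ω|−1) ≥ ln(2|Ω|/δ)/(2ε²)`, then with probability at least `1−δ` the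
empirical mean of `A` over the sample is within `ε` of the population mean `μ`. -/
theorem stmt2 {Ω : Type*} [Fintype Ω] (hΩ : 2 ≤ Fintype.card Ω)
    (A : Ω → ℝ) (hA0 : ∀ ω, 0 ≤ A ω) (hA1 : ∀ ω, A ω ≤ 1)
    (μ : ℝ) (hμ : μ = (1 / (Fintype.card Ω : ℝ)) * ∑ ω, A ω)
    (L : ℕ) (hL1 : 1 ≤ L) (hL2 : L ≤ Fintype.card Ω)
    (ε δ : ℝ) (hε : 0 < ε) (hδ : δ ∈ Set.Ioo (0 : ℝ) 1)
    (hcond : (L : ℝ) * (((Fintype.card Ω : ℝ) - L) / ((Fintype.card Ω : ℝ) - 1))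
        ≥ Real.log (2 * (Fintype.card Ω : ℝ) / δ) / (2 * ε ^ 2)) :
    1 - δ ≤
      ((Finset.univ.filter (fun s : Fin L ↪ Ω =>
          |(1 / (L : ℝ)) * (∑ l, A (s l)) - μ| ≤ ε)).card : ℝ)
        / (Fintype.card (Fin L ↪ Ω) : ℝ) := by
  obtain ⟨hδ0, hδ1⟩ := hδ
  haveI : Nonempty Ω := Fintype.card_pos_iff.1 (by omega)
  have hN2 : (2:ℝ) ≤ Fintype.card Ω := by exact_mod_cast hΩ
  have hLr : (1:ℝ) ≤ L := by exact_mod_cast hL1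
  have hD : (0:ℝ) < (Fintype.card Ω).descFactorial L := by
    exact_mod_cast Nat.descFactorial_pos.2 hL2
  have hsum : ∑ w, A w = Fintype.card Ω * μ := by rw [hμ]; field_simp
  -- the exponential bound
  have hexp : 2 * Real.exp (-(2 * L * ε ^ 2)) ≤ δ := by
    have h1 : (L : ℝ) * (((Fintype.card Ω : ℝ) - L) / ((Fintype.card Ω : ℝ) - 1)) ≤ L := by
      refine mul_le_of_le_one_right (by linarith) ?_
      rw [div_le_one (by linarith)]; linarith
    have h2 := hcond.le.trans h1
    rw [div_le_iff₀ (by positivity)] at h2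
    have h3 : Real.log (2 / δ) ≤ 2 * L * ε ^ 2 := by
      refine le_trans (Real.log_le_log (by positivity) ?_) (h2.trans (le_of_eq (by ring)))
      gcongr; linarith
    have h4 : 2 / δ ≤ Real.exp (2 * L * ε ^ 2) := (Real.log_le_iff_le_exp (by positivity)).1 h3
    rw [div_le_iff₀ hδ0] at h4
    rw [Real.exp_neg, ← div_eq_mul_inv, div_le_iff₀ (Real.exp_pos _)]
    linarith
  have t1 := aux_tail (fun w => A w - μ) (0 - μ) (1 - μ)
    (fun w => ⟨by linarith [hA0 w], by linarith [hA1 w]⟩) (by ring)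
    (by rw [Finset.sum_sub_distrib, hsum]; simp) L hL2 ε hε
  have t2 := aux_tail (fun w => μ - A w) (μ - 1) (μ - 0)
    (fun w => ⟨by linarith [hA1 w], by linarith [hA0 w]⟩) (by ring)
    (by rw [Finset.sum_sub_distrib, hsum]; simp) L hL2 ε hε
  have hcard : Fintype.card (Fin L ↪ Ω) = (Fintype.card Ω).descFactorial L := by
    rw [Fintype.card_embedding_eq, Fintype.card_fin]
  have hsplit := Finset.card_filter_add_card_filter_not (s := (Finset.univ : Finset (Fin L ↪ Ω)))
    (fun s : Fin L ↪ Ω => |(1 / (L : ℝ)) * (∑ l, A (s l)) - μ| ≤ ε)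
  rw [Finset.card_univ, hcard] at hsplit
  have hbad : (Finset.univ.filter (fun s : Fin L ↪ Ω =>
      ¬ |(1 / (L : ℝ)) * (∑ l, A (s l)) - μ| ≤ ε)).card ≤
      (Finset.univ.filter (fun s : Fin L ↪ Ω => L * ε < ∑ l, (A (s l) - μ))).card +
      (Finset.univ.filter (fun s : Fin L ↪ Ω => L * ε < ∑ l, (μ - A (s l)))).card := by
    refine (Finset.card_le_card ?_).trans (Finset.card_union_le _ _)
    intro s hs
    simp only [Finset.mem_union, Finset.mem_filter, Finset.mem_univ, true_and, not_le,
      lt_abs, Finset.sum_sub_distrib, Finset.sum_const, Finset.card_univ, Fintype.card_fin,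
      nsmul_eq_mul] at hs ⊢
    have e : (L:ℝ) * ((1 / (L : ℝ)) * (∑ l, A (s l)) - μ) = ∑ l, A (s l) - L * μ := by
      field_simp
    rcases hs with hs | hs
    · left; nlinarith
    · right; nlinarith
  rw [hcard, le_div_iff₀ hD]
  have hs' := congrArg (Nat.cast (R := ℝ)) hsplit
  have hb' := (Nat.cast_le (α := ℝ)).2 hbad
  push_cast at hs' hb'
  have := mul_le_mul_of_nonneg_left hexp hD.le
  linarith
end

section
/- Let Ω be a finite type with |Ω| ≥ 2, let A : Ω → ℝ satisfy 0 ≤ A(ω) ≤ 1 for all ω, and let μ = (1/|Ω|)·Σ_{ω ∈ Ω} A(ω). Fix 1 ≤ L ≤ |Ω| and ε > 0. Then, under the uniform distribution on injective functions s : Fin L → Ω, the probability that |(1/L)·Σ_{l} A(s(l)) − μ| ≥ ε is at most 2 · exp( −2 ε² · L · (|Ω| − L)/(|Ω| − 1) ). -/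
open scoped Classical

lemma aux_mono (L : ℕ) (m z : ℝ) (hm : 0 ≤ m) (hz : 0 ≤ z) : 0 ≤ (m - z) * (m ^ L - z ^ L) := by
  rcases le_total m z with h | h
  · exact mul_nonneg_of_nonpos_of_nonpos (by linarith) (by linarith [pow_le_pow_left₀ hm h L])
  · exact mul_nonneg (by linarith) (by linarith [pow_le_pow_left₀ hz h L])

lemma aux_base (L : ℕ) (m z : ℝ) (hm : 0 ≤ m) (hz : 0 ≤ z) :
    ((L : ℝ) + 1) * m * z ^ L ≤ m ^ (L + 1) + L * z ^ (L + 1) := by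
  induction L with
  | zero => simp
  | succ k ih =>
    have h1 := aux_mono (k + 1) m z hm hz
    have h2 := mul_le_mul_of_nonneg_left ih hz
    push_cast
    ring_nf at h1 h2 ⊢
    linarith

lemma aux_tan (L : ℕ) (n m z : ℝ) (hn : (L : ℝ) ≤ n) (hm : 0 ≤ m) (hz : 0 ≤ z) :
    ((n + 1) * m - n * z) * z ^ L ≤ m ^ (L + 1) + (n - L) * m ^ L * (m - z) := by
  have h1 := mul_nonneg (sub_nonneg.2 hn) (aux_mono L m z hm hz)
  have h2 := aux_base L m z hm hz
  ring_nf at h1 h2 ⊢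
  linarith

def embEquiv (n : ℕ) (Ω : Type*) : (Fin (n + 1) ↪ Ω) ≃ Σ ω : Ω, (Fin n ↪ {x : Ω // x ≠ ω}) where
  toFun s := ⟨s 0, ⟨fun i => ⟨s i.succ, fun h => Fin.succ_ne_zero i (s.injective h)⟩,
    fun i j h => Fin.succ_injective _ (s.injective (Subtype.ext_iff.1 h))⟩⟩
  invFun p := ⟨Fin.cons p.1 (fun i => (p.2 i : Ω)), by
    rw [Fin.cons_injective_iff]
    refine ⟨?_, fun i j h => p.2.injective (Subtype.ext h)⟩
    rintro ⟨i, hi⟩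
    exact (p.2 i).2 hi⟩
  left_inv s := by
    ext i
    refine Fin.cases ?_ (fun i => ?_) i
    · simp
    · simp
      rfl
  right_inv p := by
    rcases p with ⟨ω, e⟩
    rfl

lemma maclaurin (L : ℕ) : ∀ {Ω : Type*} [Fintype Ω] (_ : L ≤ Fintype.card Ω)
    (f : Ω → ℝ) (_ : ∀ ω, 0 ≤ f ω),
    ∑ s : Fin L ↪ Ω, ∏ l, f (s l) ≤
      ((Fintype.card Ω).descFactorial L : ℝ) * ((∑ ω, f ω) / Fintype.card Ω) ^ L := by
  induction L with
  | zero => intro Ω _ _ f _; simp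
  | succ L ih =>
    intro Ω _ hL f hf
    obtain ⟨n, hn⟩ : ∃ n, Fintype.card Ω = n + 1 := ⟨Fintype.card Ω - 1, by omega⟩
    have hLn : L ≤ n := by omega
    have hc : ∀ ω : Ω, Fintype.card {x : Ω // x ≠ ω} = n := by
      intro ω
      rw [Fintype.card_subtype_compl, hn]; simp
    have hs : ∀ ω : Ω, ∑ x : {x : Ω // x ≠ ω}, f x = (∑ x, f x) - f ω := by
      intro ω
      have h := Fintype.sum_eq_add_sum_subtype_ne f ω
      rw [h, add_sub_cancel_left]
    have e1 : ∑ s : Fin (L + 1) ↪ Ω, ∏ l, f (s l) =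
        ∑ ω : Ω, f ω * ∑ e : Fin L ↪ {x : Ω // x ≠ ω}, ∏ l, f (e l) := by
      rw [Fintype.sum_equiv (embEquiv L Ω) _
        (fun p => f p.1 * ∏ l, f (p.2 l)) ?_, Fintype.sum_sigma]
      · simp only [Finset.mul_sum]
      · intro s
        rw [Fin.prod_univ_succ]
        rfl
    have e2 : ∀ ω : Ω, f ω * ∑ e : Fin L ↪ {x : Ω // x ≠ ω}, ∏ l, f (e l) ≤
        (n.descFactorial L : ℝ) * (f ω * (((∑ x, f x) - f ω) / n) ^ L) := by
      intro ω
      have := ih (Ω := {x : Ω // x ≠ ω}) (by rw [hc]; exact hLn) (fun x => f x) (fun x => hf x)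
      rw [hc, hs] at this
      have := mul_le_mul_of_nonneg_left this (hf ω)
      linarith
    rw [e1]
    refine (Finset.sum_le_sum fun ω _ => e2 ω).trans ?_
    rw [← Finset.mul_sum, hn, Nat.succ_descFactorial_succ]
    set S := ∑ x, f x with hS
    have hS0 : 0 ≤ S := Finset.sum_nonneg fun x _ => hf x
    suffices h : ∑ ω, f ω * ((S - f ω) / n) ^ L ≤ ((n : ℝ) + 1) * (S / ((n : ℝ) + 1)) ^ (L + 1) by
      have := mul_le_mul_of_nonneg_left h (Nat.cast_nonneg (α := ℝ) (n.descFactorial L))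
      push_cast
      linarith
    rcases Nat.eq_zero_or_pos L with rfl | hLp
    · simp only [pow_zero, mul_one, zero_add, pow_one]
      rw [← hS]
      apply le_of_eq
      field_simp
    have hn0 : (0 : ℝ) < n := by exact_mod_cast (by omega : 0 < n)
    set m := S / ((n : ℝ) + 1) with hm
    have hSm : S = (n + 1) * m := by rw [hm]; field_simp
    have hm0 : 0 ≤ m := by positivity
    have key : ∀ ω, f ω * ((S - f ω) / n) ^ L ≤
        m ^ (L + 1) + (n - L) * m ^ L * (m - (S - f ω) / n) := by
      intro ω
      have hz : 0 ≤ (S - f ω) / n := by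
        have : f ω ≤ S := Finset.single_le_sum (fun x _ => hf x) (Finset.mem_univ ω)
        apply div_nonneg <;> linarith
      have := aux_tan L n m ((S - f ω) / n) (by exact_mod_cast hLn) hm0 hz
      have h3 : ((n : ℝ) + 1) * m - n * ((S - f ω) / n) = f ω := by
        rw [← hSm]; field_simp; ring
      rwa [h3] at this
    refine (Finset.sum_le_sum fun ω _ => key ω).trans (le_of_eq ?_)
    clear_value m
    rw [Finset.sum_add_distrib, ← Finset.mul_sum, Finset.sum_sub_distrib, ← Finset.sum_div,
      Finset.sum_sub_distrib, ← hS]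
    simp only [Finset.sum_const, Finset.card_univ, hn, nsmul_eq_mul]
    push_cast
    have : ((n : ℝ) + 1) * m - (((n : ℝ) + 1) * S - S) / n = 0 := by
      rw [← hSm]; field_simp; ring
    rw [this]; ring

lemma hoeff_mgf {Ω : Type*} [Fintype Ω] [Nonempty Ω] (A : Ω → ℝ) (hA0 : ∀ ω, 0 ≤ A ω)
    (hA1 : ∀ ω, A ω ≤ 1) (t : ℝ) :
    (∑ ω, Real.exp (t * (A ω - (∑ ω, A ω) / Fintype.card Ω))) / Fintype.card Ω
      ≤ Real.exp (t ^ 2 / 8) := by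
  letI : MeasurableSpace Ω := ⊤
  haveI : MeasurableSingletonClass Ω := ⟨fun _ => trivial⟩
  let P : MeasureTheory.Measure Ω := (PMF.uniformOfFintype Ω).toMeasure
  have hint : ∀ g : Ω → ℝ, ∫ ω, g ω ∂P = (∑ ω, g ω) / Fintype.card Ω := by
    intro g
    rw [PMF.integral_eq_sum]
    simp [div_eq_inv_mul, Finset.mul_sum]
  have h := (ProbabilityTheory.hasSubgaussianMGF_of_mem_Icc (μ := P) (X := A) (a := 0) (b := 1)
    (measurable_from_top.aemeasurable) (Filter.Eventually.of_forall fun ω => ⟨hA0 ω, hA1 ω⟩)).mgf_le t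
  rw [ProbabilityTheory.mgf, hint, hint] at h
  refine h.trans (le_of_eq ?_)
  congr 1
  simp
  ring

lemma one_side {Ω : Type*} [Fintype Ω] [Nonempty Ω] (A : Ω → ℝ) (hA0 : ∀ ω, 0 ≤ A ω)
    (hA1 : ∀ ω, A ω ≤ 1) (L : ℕ) (hL2 : L ≤ Fintype.card Ω) (ε : ℝ) (hε : 0 < ε) :
    ((Finset.univ.filter (fun s : Fin L ↪ Ω =>
        L * ε ≤ ∑ l, (A (s l) - (∑ ω, A ω) / Fintype.card Ω))).card : ℝ)
      ≤ (Fintype.card (Fin L ↪ Ω) : ℝ) * Real.exp (-2 * ε ^ 2 * L) := by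
  set μ := (∑ ω, A ω) / Fintype.card Ω with hμ
  have h1 := maclaurin L hL2 (fun ω => Real.exp ((4 * ε) * (A ω - μ))) (fun _ => (Real.exp_pos _).le)
  have h2 := hoeff_mgf A hA0 hA1 (4 * ε)
  rw [← hμ] at h2
  have h3 := pow_le_pow_left₀ (by positivity) h2 L
  have h4 : ((Finset.univ.filter (fun s : Fin L ↪ Ω =>
        L * ε ≤ ∑ l, (A (s l) - μ))).card : ℝ) * Real.exp (4 * ε * (L * ε)) ≤
      ∑ s : Fin L ↪ Ω, ∏ l, Real.exp ((4 * ε) * (A (s l) - μ)) := by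
    rw [← nsmul_eq_mul, ← Finset.sum_const]
    refine (Finset.sum_le_sum fun s hs => ?_).trans
      (Finset.sum_le_sum_of_subset_of_nonneg (Finset.filter_subset _ _)
        fun s _ _ => Finset.prod_nonneg fun l _ => (Real.exp_pos _).le)
    rw [← Real.exp_sum, ← Finset.mul_sum]
    apply Real.exp_le_exp.2
    exact mul_le_mul_of_nonneg_left (Finset.mem_filter.1 hs).2 (by positivity)
  have h5 : (Fintype.card (Fin L ↪ Ω) : ℝ) = ((Fintype.card Ω).descFactorial L : ℝ) := by
    rw [Fintype.card_embedding_eq, Fintype.card_fin]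
  have h6 := (h4.trans h1).trans (mul_le_mul_of_nonneg_left h3 (Nat.cast_nonneg _))
  rw [← h5, ← Real.exp_nat_mul, ← le_div_iff₀ (Real.exp_pos _), mul_div_assoc, ← Real.exp_sub] at h6
  have h7 : (L : ℝ) * ((4 * ε) ^ 2 / 8) - 4 * ε * (L * ε) = -2 * ε ^ 2 * L := by ring
  rwa [h7] at h6

theorem stmt3 {Ω : Type*} [Fintype Ω] (hΩ : 2 ≤ Fintype.card Ω)
    (A : Ω → ℝ) (hA0 : ∀ ω, 0 ≤ A ω) (hA1 : ∀ ω, A ω ≤ 1)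
    (μ : ℝ) (hμ : μ = (1 / (Fintype.card Ω : ℝ)) * ∑ ω, A ω)
    (L : ℕ) (hL1 : 1 ≤ L) (hL2 : L ≤ Fintype.card Ω)
    (ε : ℝ) (hε : 0 < ε) :
    ((Finset.univ.filter (fun s : Fin L ↪ Ω =>
        ε ≤ |(1 / (L : ℝ)) * (∑ l, A (s l)) - μ|)).card : ℝ)
        / (Fintype.card (Fin L ↪ Ω) : ℝ)
      ≤ 2 * Real.exp (-2 * ε ^ 2 * ((L : ℝ) *
          (((Fintype.card Ω : ℝ) - L) / ((Fintype.card Ω : ℝ) - 1)))) := by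
  haveI : Nonempty Ω := Fintype.card_pos_iff.1 (by omega)
  have hN : (2 : ℝ) ≤ Fintype.card Ω := by exact_mod_cast hΩ
  have hL1' : (1 : ℝ) ≤ L := by exact_mod_cast hL1
  have hμ' : (∑ ω, A ω) / Fintype.card Ω = μ := by rw [hμ]; ring
  have hμ2 : (∑ ω, (1 - A ω)) / Fintype.card Ω = 1 - μ := by
    rw [Finset.sum_sub_distrib, sub_div, hμ']
    simp
  have a1 := one_side A hA0 hA1 L hL2 ε hε
  have a2 := one_side (fun ω => 1 - A ω) (fun ω => by linarith [hA1 ω])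
    (fun ω => by linarith [hA0 ω]) L hL2 ε hε
  rw [hμ'] at a1
  rw [hμ2] at a2
  have hsub : (Finset.univ.filter (fun s : Fin L ↪ Ω =>
        ε ≤ |(1 / (L : ℝ)) * (∑ l, A (s l)) - μ|)) ⊆
      (Finset.univ.filter (fun s : Fin L ↪ Ω => L * ε ≤ ∑ l, (A (s l) - μ))) ∪
      (Finset.univ.filter (fun s : Fin L ↪ Ω => L * ε ≤ ∑ l, ((1 - A (s l)) - (1 - μ)))) := by
    intro s hs
    have hs := (Finset.mem_filter.1 hs).2
    have e1 : ∑ l, (A (s l) - μ) = L * ((1 / (L : ℝ)) * (∑ l, A (s l)) - μ) := by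
      rw [Finset.sum_sub_distrib]
      simp
      field_simp
    have e2 : ∑ l, ((1 - A (s l)) - (1 - μ)) = L * -((1 / (L : ℝ)) * (∑ l, A (s l)) - μ) := by
      rw [mul_neg, ← e1, ← Finset.sum_neg_distrib]
      exact Finset.sum_congr rfl fun l _ => by ring
    simp only [Finset.mem_union, Finset.mem_filter, Finset.mem_univ, true_and]
    rw [e1, e2]
    rcases le_abs.1 hs with h | h
    · left; gcongr
    · right; gcongr
  have hc := (Nat.cast_le (α := ℝ)).2 ((Finset.card_le_card hsub).trans (Finset.card_union_le _ _))
  push_cast at hc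
  have hpos : (0 : ℝ) < Fintype.card (Fin L ↪ Ω) := by
    rw [Fintype.card_embedding_eq, Fintype.card_fin]
    exact_mod_cast Nat.descFactorial_pos.2 hL2
  rw [div_le_iff₀ hpos]
  have hexp : Real.exp (-2 * ε ^ 2 * L) ≤ Real.exp (-2 * ε ^ 2 * ((L : ℝ) *
          (((Fintype.card Ω : ℝ) - L) / ((Fintype.card Ω : ℝ) - 1)))) := by
    apply Real.exp_le_exp.2
    have h1 : ((Fintype.card Ω : ℝ) - L) / ((Fintype.card Ω : ℝ) - 1) ≤ 1 := by
      rw [div_le_one (by linarith)]; linarith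
    have h2 := mul_le_mul_of_nonneg_left h1 (by positivity : 0 ≤ 2 * ε ^ 2 * (L : ℝ))
    linarith
  have := mul_le_mul_of_nonneg_left hexp hpos.le
  linarith
end

section
/- Let Ω be a finite type and E ⊆ Ω a subset, and let 1 ≤ L ≤ |Ω|. Then, under the uniform distribution on injective functions s : Fin L → Ω, the probability that s(l) ∉ E for every l ∈ Fin L is at most exp( −L · |E| / |Ω| ). -/
open scoped Classical

theorem desc_bound (n e : ℕ) (he : e ≤ n) (hn : 0 < n) (L : ℕ) (hL : L ≤ n) :
    (((n - e).descFactorial L : ℕ) : ℝ) ≤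
      Real.exp (-(e : ℝ) / n) ^ L * ((n.descFactorial L : ℕ) : ℝ) := by
  induction L with
  | zero => simp
  | succ k ih =>
    have ih := ih (by omega)
    rw [Nat.descFactorial_succ, Nat.descFactorial_succ, Nat.cast_mul, Nat.cast_mul, pow_succ]
    have hn' : (0 : ℝ) < n := by exact_mod_cast hn
    have step : ((n - e - k : ℕ) : ℝ) ≤ Real.exp (-(e : ℝ) / n) * ((n - k : ℕ) : ℝ) := by
      by_cases h : n - e ≤ k
      · rw [Nat.sub_eq_zero_of_le h]
        simp only [Nat.cast_zero]
        positivity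
      · have h1 : ((n - e - k : ℕ) : ℝ) = n - e - k := by
          rw [Nat.cast_sub (by omega), Nat.cast_sub he]
        have h2 : ((n - k : ℕ) : ℝ) = n - k := by
          rw [Nat.cast_sub (by omega)]
        have h3 := Real.add_one_le_exp (-(e : ℝ) / n)
        have h4 : (0 : ℝ) ≤ (n : ℝ) - k := by rw [← h2]; positivity
        rw [h1, h2]
        refine le_trans ?_ (mul_le_mul_of_nonneg_right h3 h4)
        have h5 : (-(e : ℝ) / n + 1) * (n - k) = n - e - k + e * k / n := by
          field_simp
          ring
        rw [h5]
        have : (0 : ℝ) ≤ (e : ℝ) * k / n := by positivity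
        linarith
    calc ((n - e - k : ℕ) : ℝ) * (((n - e).descFactorial k : ℕ) : ℝ)
        ≤ (Real.exp (-(e : ℝ) / n) * ((n - k : ℕ) : ℝ)) *
          (Real.exp (-(e : ℝ) / n) ^ k * ((n.descFactorial k : ℕ) : ℝ)) := by gcongr
      _ = _ := by ring

theorem filter_bound {Ω : Type*} [Fintype Ω] (E : Finset Ω) (L : ℕ) :
    (Finset.univ.filter (fun s : Fin L ↪ Ω => ∀ l : Fin L, s l ∉ E)).card
      ≤ (Fintype.card Ω - E.card).descFactorial L := by
  have h : Fintype.card (Fin L ↪ {x // x ∉ E}) = (Fintype.card Ω - E.card).descFactorial L := by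
    rw [Fintype.card_embedding_eq, Fintype.card_fin, Fintype.card_subtype_compl,
      Fintype.card_coe]
  rw [← h, ← Fintype.card_subtype]
  refine Fintype.card_le_of_injective
    (fun s => (⟨fun l => ⟨s.1 l, s.2 l⟩, fun a b hab => s.1.injective (congrArg Subtype.val hab)⟩ :
      Fin L ↪ {x // x ∉ E})) ?_
  intro s t hst
  apply Subtype.ext
  ext l
  exact congrArg Subtype.val (DFunLike.congr_fun hst l)

/-- Under the uniform distribution on injective functions `Fin L ↪ Ω` (sampling `L`
elements without replacement), the probability that the sample entirely avoids a
subset `E ⊆ Ω` is at most `exp(−L·|E|/|Ω|)`. -/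
theorem stmt5 {Ω : Type*} [Fintype Ω] (E : Finset Ω)
    (L : ℕ) (hL1 : 1 ≤ L) (hL2 : L ≤ Fintype.card Ω) :
    ((Finset.univ.filter (fun s : Fin L ↪ Ω =>
        ∀ l : Fin L, s l ∉ E)).card : ℝ) / (Fintype.card (Fin L ↪ Ω) : ℝ)
      ≤ Real.exp (-(L : ℝ) * (E.card : ℝ) / (Fintype.card Ω : ℝ)) := by
  have h1 := desc_bound (Fintype.card Ω) E.card (Finset.card_le_univ E) (by omega) L hL2
  have h2 : ((Finset.univ.filter (fun s : Fin L ↪ Ω => ∀ l : Fin L, s l ∉ E)).card : ℝ)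
      ≤ (((Fintype.card Ω - E.card).descFactorial L : ℕ) : ℝ) := by
    exact_mod_cast filter_bound E L
  have h3 : Fintype.card (Fin L ↪ Ω) = (Fintype.card Ω).descFactorial L := by
    rw [Fintype.card_embedding_eq, Fintype.card_fin]
  have h4 : (0 : ℝ) < (((Fintype.card Ω).descFactorial L : ℕ) : ℝ) := by
    exact_mod_cast Nat.descFactorial_pos.mpr hL2
  rw [h3, div_le_iff₀ h4]
  refine (h2.trans h1).trans (le_of_eq ?_)
  rw [← Real.exp_nat_mul]
  congr 2
  ring
end

section
/- Let K ≥ 2 and let X : Fin K → Fin K → ℝ be any function. Then, under the uniform distribution on bijections σ : Fin K → Fin K, the expectation of Σ_{t : t+1 < K} X(σ(t), σ(t+1)) equals (1/K) · Σ_{i ≠ j} X(i, j). -/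
theorem aux_const {K : ℕ} (X : Fin K → Fin K → ℝ) (a b c d : Fin K) (hab : a ≠ b) (hcd : c ≠ d) :
    ∑ σ : Equiv.Perm (Fin K), X (σ a) (σ b) = ∑ σ : Equiv.Perm (Fin K), X (σ c) (σ d) := by
  obtain ⟨τ, h1, h2⟩ : ∃ τ : Equiv.Perm (Fin K), τ a = c ∧ τ b = d := by
    refine ⟨Equiv.swap (Equiv.swap a c b) d * Equiv.swap a c, ?_, ?_⟩
    · rw [Equiv.Perm.mul_apply, Equiv.swap_apply_left]
      refine Equiv.swap_apply_of_ne_of_ne ?_ hcd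
      intro h
      apply hab
      apply (Equiv.swap a c).injective
      rw [Equiv.swap_apply_left]
      exact h
    · rw [Equiv.Perm.mul_apply, Equiv.swap_apply_left]
  rw [← Equiv.sum_comp (Equiv.mulRight τ) (fun σ : Equiv.Perm (Fin K) => X (σ a) (σ b))]
  refine Finset.sum_congr rfl fun σ _ => ?_
  rw [← h1, ← h2]
  simp

theorem aux_total {K : ℕ} (X : Fin K → Fin K → ℝ) (σ : Equiv.Perm (Fin K)) :
    ∑ p ∈ Finset.univ.filter (fun p : Fin K × Fin K => p.1 ≠ p.2), X (σ p.1) (σ p.2)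
      = ∑ p ∈ Finset.univ.filter (fun p : Fin K × Fin K => p.1 ≠ p.2), X p.1 p.2 := by
  rw [Finset.sum_filter, Finset.sum_filter,
    ← Equiv.sum_comp (Equiv.prodCongr σ σ)
      (fun p : Fin K × Fin K => if p.1 ≠ p.2 then X p.1 p.2 else 0)]
  simp

theorem aux_card (K : ℕ) :
    ((Finset.univ.filter (fun p : Fin K × Fin K => p.1 ≠ p.2)).card : ℝ) = K * K - K := by
  have h : Finset.univ.filter (fun p : Fin K × Fin K => p.1 ≠ p.2)
      = (Finset.univ : Finset (Fin K)).offDiag := by ext; simp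
  rw [h, Finset.offDiag_card, Nat.cast_sub (by simp; exact Nat.le_mul_self K)]
  simp

/-- Under the uniform distribution on permutations `σ : Fin K → Fin K`, the expectation
of the sum `Σ_{t : t+1<K} X(σ(t), σ(t+1))` of values attached to adjacent positions
equals `(1/K) · Σ_{i ≠ j} X(i,j)`. -/
theorem stmt8 (K : ℕ) (hK : 2 ≤ K) (X : Fin K → Fin K → ℝ) :
    (1 / (Fintype.card (Equiv.Perm (Fin K)) : ℝ)) *
      ∑ σ : Equiv.Perm (Fin K), ∑ t : Fin (K - 1),
        X (σ ⟨(t : ℕ), by have := t.isLt; omega⟩)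
          (σ ⟨(t : ℕ) + 1, by have := t.isLt; omega⟩)
      = (1 / (K : ℝ)) *
        ∑ p ∈ Finset.univ.filter (fun p : Fin K × Fin K => p.1 ≠ p.2), X p.1 p.2 := by
  have hne : (⟨0, by omega⟩ : Fin K) ≠ ⟨1, by omega⟩ := by simp
  set F := ∑ σ : Equiv.Perm (Fin K), X (σ ⟨0, by omega⟩) (σ ⟨1, by omega⟩) with hF
  set S := ∑ p ∈ Finset.univ.filter (fun p : Fin K × Fin K => p.1 ≠ p.2), X p.1 p.2 with hS
  have key : ((K : ℝ) * K - K) * F = (Fintype.card (Equiv.Perm (Fin K)) : ℝ) * S := by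
    have e1 : ∑ p ∈ Finset.univ.filter (fun p : Fin K × Fin K => p.1 ≠ p.2),
        ∑ σ : Equiv.Perm (Fin K), X (σ p.1) (σ p.2) = ((K : ℝ) * K - K) * F := by
      rw [Finset.sum_congr rfl (fun p hp =>
        aux_const X p.1 p.2 _ _ (Finset.mem_filter.mp hp).2 hne), Finset.sum_const,
        nsmul_eq_mul, aux_card]
    rw [← e1, Finset.sum_comm, Finset.sum_congr rfl (fun σ _ => aux_total X σ),
      Finset.sum_const, nsmul_eq_mul, Finset.card_univ]
  have hL : ∑ σ : Equiv.Perm (Fin K), ∑ t : Fin (K - 1),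
        X (σ ⟨(t : ℕ), by have := t.isLt; omega⟩)
          (σ ⟨(t : ℕ) + 1, by have := t.isLt; omega⟩) = ((K : ℝ) - 1) * F := by
    rw [Finset.sum_comm, Finset.sum_congr rfl (fun t _ =>
        aux_const X _ _ _ _ (by simp) hne), Finset.sum_const, nsmul_eq_mul, Finset.card_univ,
        Fintype.card_fin, Nat.cast_sub (by omega), Nat.cast_one]
  rw [hL]
  have hc : (Fintype.card (Equiv.Perm (Fin K)) : ℝ) ≠ 0 := by
    exact_mod_cast Fintype.card_ne_zero
  have hk : (K : ℝ) ≠ 0 := by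
    have : K ≠ 0 := by omega
    exact_mod_cast this
  rw [one_div_mul_eq_div, one_div_mul_eq_div, div_eq_div_iff hc hk]
  linarith
end

section
/- For every natural number K ≥ 2, Σ_{t=1}^{K−1} 1/( t·(K−t) + 1 ) ≤ 2·( ln K + 1 ) / K, where all quantities are real numbers and ln is the natural logarithm. -/
/-- The bound `Σ_{t=1}^{K−1} 1/(t(K−t)+1) ≤ 2(ln K + 1)/K` used in the greedy
strategy optimality analysis. -/
theorem stmt11 (K : ℕ) (hK : 2 ≤ K) :
    ∑ t ∈ Finset.Icc 1 (K - 1), (1 : ℝ) / ((t : ℝ) * ((K : ℝ) - (t : ℝ)) + 1)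
      ≤ 2 * (Real.log (K : ℝ) + 1) / (K : ℝ) := by
  obtain ⟨n, rfl⟩ : ∃ n, K = n + 1 := ⟨K - 1, by omega⟩
  have hn : 1 ≤ n := by omega
  have hn' : (0 : ℝ) < n := by exact_mod_cast hn
  simp only [Nat.add_sub_cancel]
  have hH := harmonic_le_one_add_log n
  rw [harmonic_eq_sum_Icc] at hH
  push_cast at hH
  have hrefl : ∑ t ∈ Finset.Icc 1 n, (((n + 1 - t : ℕ) : ℝ))⁻¹
      = ∑ t ∈ Finset.Icc 1 n, ((t : ℝ))⁻¹ := by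
    refine Finset.sum_nbij' (fun t => n + 1 - t) (fun t => n + 1 - t) ?_ ?_ ?_ ?_ ?_
    all_goals intro t ht
    all_goals simp only [Finset.mem_Icc] at *
    all_goals omega
  have hlog : Real.log n ≤ Real.log ((n + 1 : ℕ) : ℝ) :=
    Real.log_le_log hn' (by push_cast; linarith)
  have hpos : (0 : ℝ) < ((n + 1 : ℕ) : ℝ) := by positivity
  rw [le_div_iff₀ hpos, Finset.sum_mul]
  have key : ∀ t ∈ Finset.Icc 1 n,
      (1 : ℝ) / ((t : ℝ) * (((n + 1 : ℕ) : ℝ) - (t : ℝ)) + 1) * ((n + 1 : ℕ) : ℝ)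
      ≤ (t : ℝ)⁻¹ + (((n + 1 - t : ℕ) : ℝ))⁻¹ := by
    intro t ht
    rw [Finset.mem_Icc] at ht
    have h1 : (0 : ℝ) < t := by exact_mod_cast ht.1
    have h2 : (t : ℝ) ≤ n := by exact_mod_cast ht.2
    rw [Nat.cast_sub (by omega)]
    have h3 : (0 : ℝ) < ((n + 1 : ℕ) : ℝ) - t := by push_cast; linarith
    have e : (t : ℝ)⁻¹ + (((n + 1 : ℕ) : ℝ) - t)⁻¹
        = 1 / ((t : ℝ) * (((n + 1 : ℕ) : ℝ) - (t : ℝ))) * ((n + 1 : ℕ) : ℝ) := by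
      have := h1.ne'
      have := h3.ne'
      field_simp
      ring
    rw [e]
    have h4 := mul_pos h1 h3
    gcongr
    linarith
  refine (Finset.sum_le_sum key).trans ?_
  rw [Finset.sum_add_distrib, hrefl]
  linarith
end
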